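/- Let p ≥ 2, α = p−1 and θ ≥ 0, and let 0 < σ ≤ μ_{α,θ} and 0 < μ < σ. Then TMSC(μ,α,θ) ≤ [ (μ/σ)^{p−1} / (1 − (μ/σ)^{p−1}) ] · TMC(σ,α,θ). In particular, if TMC(μ_{α,θ},α,θ) is finite then TMSC(μ,α,θ) is finite for every μ ∈ (0, μ_{α,θ}). -/

import Mathlib

open MeasureTheory Real Filter ENNReal

/-- The fractional-dimension spherical volume constant `ω_θ = 2π^((θ+1)/2)/Γ((θ+1)/2)`. -/
noncomputable def omegaW (θ : ℝ) : ℝ := 2 * Real.pi ^ ((θ + 1) / 2) / Real.Gamma ((θ + 1) / 2)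

/-- Weighted integral `∫₀^∞ f dλ_θ = ω_θ ∫₀^∞ f(r) r^θ dr` (for nonnegative integrands,
valued in `ℝ≥0∞`). -/
noncomputable def wInt (θ : ℝ) (f : ℝ → ℝ) : ℝ≥0∞ :=
  ENNReal.ofReal (omegaW θ) *
    ∫⁻ r in Set.Ioi (0 : ℝ), ENNReal.ofReal (f r) * ENNReal.ofReal (r ^ θ)

/-- The weighted Lebesgue norm `‖u‖_{L^q_θ}` (valued in `ℝ≥0∞`). -/
noncomputable def wNorm (θ q : ℝ) (u : ℝ → ℝ) : ℝ≥0∞ :=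
  (wInt θ fun r => |u r| ^ q) ^ (1 / q)

/-- Membership in the weighted Sobolev space `X = X^{1,p}_∞(α,θ)`:
`u` is locally absolutely continuous on `(0,∞)` with a.e. derivative `u'`
(expressed through the fundamental theorem of calculus on compact subintervals),
`u(r) → 0` as `r → ∞`, `‖u‖_{L^p_θ} < ∞` and `‖u'‖_{L^p_α} < ∞`. -/
structure MemX (p α θ : ℝ) (u u' : ℝ → ℝ) : Prop where
  ftc_int : ∀ a b : ℝ, 0 < a → a ≤ b → IntervalIntegrable u' MeasureTheory.volume a b
  ftc : ∀ a b : ℝ, 0 < a → a ≤ b → u b - u a = ∫ t in a..b, u' t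
  lim_zero : Filter.Tendsto u Filter.atTop (nhds 0)
  fin_u : wNorm θ p u < ⊤
  fin_u' : wNorm α p u' < ⊤

/-- Full norm on `X`: `‖u‖ = (‖u‖_{L^p_θ}^p + ‖u'‖_{L^p_α}^p)^{1/p}`. -/
noncomputable def Xnorm (p α θ : ℝ) (u u' : ℝ → ℝ) : ℝ≥0∞ :=
  ((wNorm θ p u) ^ p + (wNorm α p u') ^ p) ^ (1 / p)

/-- The truncated exponential `φ_p(t) = Σ_{j ∈ ℕ, j ≥ p-1} t^j / j!`. -/
noncomputable def phiP (p t : ℝ) : ℝ :=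
  ∑' j : ℕ, if p - 1 ≤ (j : ℝ) then t ^ j / (Nat.factorial j : ℝ) else 0

/-- The critical constant `μ_{α,θ} = (θ+1) ω_α^{1/α}`. -/
noncomputable def muC (α θ : ℝ) : ℝ := (θ + 1) * (omegaW α) ^ (1 / α)

/-- The Trudinger–Moser functional `∫₀^∞ φ_p(μ |u|^{p/(p-1)}) dλ_θ`. -/
noncomputable def TMfunc (p θ μ : ℝ) (u : ℝ → ℝ) : ℝ≥0∞ :=
  wInt θ fun r => phiP p (μ * |u r| ^ (p / (p - 1)))

/-- The subcritical Trudinger–Moser supremum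
`TMSC(μ,α,θ) = sup { ‖u‖_{L^p_θ}^{-p} ∫₀^∞ φ_p(μ|u|^{p/(p-1)}) dλ_θ : u ∈ X, u ≠ 0, ‖u'‖_{L^p_α} ≤ 1 }`. -/
noncomputable def TMSC (p α θ μ : ℝ) : ℝ≥0∞ :=
  ⨆ (u : ℝ → ℝ) (u' : ℝ → ℝ) (_ : MemX p α θ u u') (_ : u ≠ 0)
    (_ : wNorm α p u' ≤ 1), (wNorm θ p u) ^ (-p) * TMfunc p θ μ u

/-- The critical Trudinger–Moser supremum
`TMC(σ,α,θ) = sup { ∫₀^∞ φ_p(σ|u|^{p/(p-1)}) dλ_θ : u ∈ X, ‖u‖ ≤ 1 }`. -/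
noncomputable def TMC (p α θ σ : ℝ) : ℝ≥0∞ :=
  ⨆ (u : ℝ → ℝ) (u' : ℝ → ℝ) (_ : MemX p α θ u u') (_ : Xnorm p α θ u u' ≤ 1),
    TMfunc p θ σ u

/-- `k₀ = min { j ∈ ℕ : j ≥ p - 1 }`. -/
noncomputable def k0 (p : ℝ) : ℕ := sInf {j : ℕ | p - 1 ≤ (j : ℝ)}

/-- `TMC(σ,α,θ)` is attained by some `u ∈ X` with `‖u‖ ≤ 1`. -/
def TMCAttained (p α θ σ : ℝ) : Prop :=
  ∃ u u' : ℝ → ℝ, MemX p α θ u u' ∧ Xnorm p α θ u u' ≤ 1 ∧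
    TMC p α θ σ = TMfunc p θ σ u

/-- `σ_* = inf { σ ∈ (0, μ_{α,θ}) : TMC(σ,α,θ) is attained }`. -/
noncomputable def sigmaStar (p α θ : ℝ) : ℝ :=
  sInf {σ : ℝ | σ ∈ Set.Ioo 0 (muC α θ) ∧ TMCAttained p α θ σ}

theorem wInt_const_mul (θ : ℝ) {c : ℝ} (hc : 0 ≤ c) (f : ℝ → ℝ) :
    wInt θ (fun r => c * f r) = ENNReal.ofReal c * wInt θ f := by
  simp only [wInt, ENNReal.ofReal_mul hc, mul_assoc]
  rw [lintegral_const_mul' _ _ ENNReal.ofReal_ne_top]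
  ring

theorem wInt_comp_mul_left (θ : ℝ) {l : ℝ} (hl : 0 < l) (f : ℝ → ℝ) :
    wInt θ f = ENNReal.ofReal (l ^ (θ + 1)) * wInt θ (fun r => f (l * r)) := by
  have himage : (fun r => l * r) '' Set.Ioi (0 : ℝ) = Set.Ioi 0 := by
    rw [Set.image_mul_left_Ioi hl, mul_zero]
  have h := lintegral_image_eq_lintegral_abs_deriv_mul (s := Set.Ioi (0 : ℝ))
    (f := fun r => l * r) (f' := fun _ => l) measurableSet_Ioi
    (fun x _ => by simpa using ((hasDerivAt_id x).const_mul l).hasDerivWithinAt)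
    ((mul_right_injective₀ hl.ne').injOn)
    (fun r => ENNReal.ofReal (f r) * ENNReal.ofReal (r ^ θ))
  rw [himage] at h
  have hcongr : ∫⁻ r in Set.Ioi (0 : ℝ), ENNReal.ofReal |l| *
        (ENNReal.ofReal (f (l * r)) * ENNReal.ofReal ((l * r) ^ θ)) =
      ∫⁻ r in Set.Ioi (0 : ℝ), ENNReal.ofReal (l ^ (θ + 1)) *
        (ENNReal.ofReal (f (l * r)) * ENNReal.ofReal (r ^ θ)) := by
    refine setLIntegral_congr_fun measurableSet_Ioi fun r hr => ?_
    rw [abs_of_pos hl, Real.mul_rpow hl.le (le_of_lt hr), Real.rpow_add hl, Real.rpow_one,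
      ENNReal.ofReal_mul (Real.rpow_nonneg hl.le θ), ENNReal.ofReal_mul (Real.rpow_nonneg hl.le θ)]
    ring
  rw [wInt, h, hcongr, lintegral_const_mul' _ _ ENNReal.ofReal_ne_top, wInt]
  ring

theorem wNorm_rpow (θ : ℝ) {p : ℝ} (hp : p ≠ 0) (u : ℝ → ℝ) :
    wNorm θ p u ^ p = wInt θ fun r => |u r| ^ p := by
  rw [wNorm, ← ENNReal.rpow_mul, one_div_mul_cancel hp, ENNReal.rpow_one]

theorem wNorm_rpow_dilation (θ : ℝ) {p l c : ℝ} (hp : p ≠ 0) (hl : 0 < l) (hc : 0 < c)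
    (u : ℝ → ℝ) :
    wNorm θ p (fun r => c * u (l * r)) ^ p =
      ENNReal.ofReal (c ^ p * l ^ (-(θ + 1))) * wNorm θ p u ^ p := by
  simp only [wNorm_rpow θ hp, abs_mul, abs_of_pos hc,
    Real.mul_rpow hc.le (abs_nonneg _), wInt_const_mul θ (Real.rpow_nonneg hc.le p)]
  rw [wInt_comp_mul_left θ hl fun r => |u r| ^ p, ← mul_assoc,
    ← ENNReal.ofReal_mul (by positivity), mul_assoc (c ^ p), ← Real.rpow_add hl,
    neg_add_cancel, Real.rpow_zero, mul_one]

theorem MemX.dilation {p α θ l c : ℝ} {u u' : ℝ → ℝ} (hp : 0 < p) (hl : 0 < l) (hc : 0 < c)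
    (h : MemX p α θ u u') :
    MemX p α θ (fun r => c * u (l * r)) (fun r => c * l * u' (l * r)) where
  ftc_int a b ha hab := by
    have := h.ftc_int (l * a) (l * b) (by positivity) (by gcongr)
    have h2 := (this.comp_mul_left (c := l)).const_mul (c * l)
    simpa [mul_div_cancel_left₀ _ hl.ne'] using h2
  ftc a b ha hab := by
    rw [intervalIntegral.integral_const_mul, mul_assoc,
      intervalIntegral.mul_integral_comp_mul_left,
      ← h.ftc (l * a) (l * b) (by positivity) (by gcongr)]
    ring
  lim_zero := by
    simpa using (h.lim_zero.comp (tendsto_id.const_mul_atTop hl)).const_mul c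
  fin_u := by
    have := ENNReal.rpow_lt_top_of_nonneg hp.le h.fin_u.ne
    rw [← ENNReal.rpow_lt_top_iff_of_pos hp, wNorm_rpow_dilation θ hp.ne' hl hc]
    exact ENNReal.mul_lt_top ENNReal.ofReal_lt_top this
  fin_u' := by
    have := ENNReal.rpow_lt_top_of_nonneg hp.le h.fin_u'.ne
    rw [← ENNReal.rpow_lt_top_iff_of_pos hp,
      wNorm_rpow_dilation α hp.ne' hl (mul_pos hc hl)]
    exact ENNReal.mul_lt_top ENNReal.ofReal_lt_top this

theorem TMfunc_le_dilation_mul_TMC {p θ σ μ l : ℝ} {u u' : ℝ → ℝ} (hp : 2 ≤ p)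
    (hσ : 0 < σ) (hμ : 0 < μ) (hl : 0 < l) (h : MemX p (p - 1) θ u u')
    (hu' : wNorm (p - 1) p u' ≤ 1)
    (hN : ENNReal.ofReal ((μ / σ) ^ (p - 1) * l ^ (-(θ + 1))) * wNorm θ p u ^ p +
      ENNReal.ofReal ((μ / σ) ^ (p - 1)) ≤ 1) :
    TMfunc p θ μ u ≤ ENNReal.ofReal (l ^ (θ + 1)) * TMC p (p - 1) θ σ := by
  have hp0 : 0 < p := by linarith
  have hp1 : p - 1 ≠ 0 := by linarith
  have hs : 0 < μ / σ := by positivity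
  set c : ℝ := (μ / σ) ^ ((p - 1) / p) with hc_def
  have hc : 0 < c := Real.rpow_pos_of_pos hs _
  have hcp : c ^ p = (μ / σ) ^ (p - 1) := by
    rw [hc_def, ← Real.rpow_mul hs.le, div_mul_cancel₀ _ hp0.ne']
  have hcq : c ^ (p / (p - 1)) = μ / σ := by
    rw [hc_def, ← Real.rpow_mul hs.le, div_mul_div_cancel₀ hp0.ne', div_self hp1, Real.rpow_one]
  have hderiv : (c * l) ^ p * l ^ (-(p - 1 + 1)) = (μ / σ) ^ (p - 1) := by
    rw [sub_add_cancel, Real.mul_rpow hc.le hl.le, mul_assoc, ← Real.rpow_add hl, add_neg_cancel,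
      Real.rpow_zero, mul_one, hcp]
  have hnorm : Xnorm p (p - 1) θ (fun r => c * u (l * r)) (fun r => c * l * u' (l * r)) ≤ 1 := by
    rw [Xnorm, wNorm_rpow_dilation θ hp0.ne' hl hc,
      wNorm_rpow_dilation (p - 1) hp0.ne' hl (mul_pos hc hl), hderiv, hcp]
    refine ENNReal.rpow_le_one (le_trans ?_ hN) (by positivity)
    gcongr
    exact mul_le_of_le_one_right' (ENNReal.rpow_le_one hu' hp0.le)
  have hfunc : TMfunc p θ μ u =
      ENNReal.ofReal (l ^ (θ + 1)) * TMfunc p θ σ (fun r => c * u (l * r)) := by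
    rw [TMfunc, wInt_comp_mul_left θ hl, TMfunc]
    simp only [abs_mul, abs_of_pos hc, Real.mul_rpow hc.le (abs_nonneg _), hcq, ← mul_assoc,
      mul_div_cancel₀ μ hσ.ne']
  rw [hfunc]
  gcongr
  exact le_iSup_of_le _ (le_iSup_of_le _ (le_iSup_of_le (h.dilation hp0 hl hc)
    (le_iSup_of_le hnorm le_rfl)))

theorem TMSC_le_mul_TMC {p θ σ μ : ℝ} (hp : 2 ≤ p) (hθ : 0 ≤ θ)
    (hσ : 0 < σ) (hμ : 0 < μ) (hμσ : μ < σ) :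
    TMSC p (p - 1) θ μ ≤
      ENNReal.ofReal ((μ / σ) ^ (p - 1) / (1 - (μ / σ) ^ (p - 1))) * TMC p (p - 1) θ σ := by
  have hp0 : 0 < p := by linarith
  have hθ1 : θ + 1 ≠ 0 := by positivity
  set s : ℝ := (μ / σ) ^ (p - 1)
  have hs : 0 < s := Real.rpow_pos_of_pos (by positivity) _
  have hs1 : s < 1 := Real.rpow_lt_one (by positivity) ((div_lt_one hσ).2 hμσ) (by linarith)
  have hK : 0 < s / (1 - s) := div_pos hs (by linarith)
  have hscale : ∀ {u u' : ℝ → ℝ}, MemX p (p - 1) θ u u' → wNorm (p - 1) p u' ≤ 1 →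
      ∀ L : ℝ, 0 < L → ENNReal.ofReal (s * L⁻¹) * wNorm θ p u ^ p + ENNReal.ofReal s ≤ 1 →
      TMfunc p θ μ u ≤ ENNReal.ofReal L * TMC p (p - 1) θ σ := by
    intro u u' h hu' L hL hN
    have hpow : (L ^ (1 / (θ + 1))) ^ (θ + 1) = L := by
      rw [← Real.rpow_mul hL.le, one_div_mul_cancel hθ1, Real.rpow_one]
    have hl : 0 < L ^ (1 / (θ + 1)) := Real.rpow_pos_of_pos hL _
    have := TMfunc_le_dilation_mul_TMC (θ := θ) hp hσ hμ hl h hu'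
      (by rwa [Real.rpow_neg hl.le, hpow])
    rwa [hpow] at this
  refine iSup_le fun u => iSup_le fun u' => iSup_le fun h => iSup_le fun _ => iSup_le fun hu' => ?_
  have hNtop : wNorm θ p u ^ p ≠ ⊤ := ENNReal.rpow_ne_top_of_nonneg hp0.le h.fin_u.ne
  rw [ENNReal.rpow_neg]
  set N := wNorm θ p u ^ p
  rcases eq_or_ne N 0 with hN0 | hN0
  · by_cases hT : TMC p (p - 1) θ σ = ⊤
    · rw [hT, ENNReal.mul_top (by simpa using hK)]
      exact le_top
    · have hzero : TMfunc p θ μ u = 0 := by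
        have hlim : Tendsto (fun L : ℝ => ENNReal.ofReal L * TMC p (p - 1) θ σ)
            (nhdsWithin 0 (Set.Ioi 0)) (nhds 0) := by
          have h0 : Tendsto (fun L : ℝ => ENNReal.ofReal L) (nhdsWithin 0 (Set.Ioi 0))
              (nhds 0) := by
            simpa using (ENNReal.continuous_ofReal.tendsto 0).mono_left nhdsWithin_le_nhds
          simpa using ENNReal.Tendsto.mul_const h0 (Or.inr hT)
        refine le_antisymm (ge_of_tendsto hlim ?_) bot_le
        filter_upwards [self_mem_nhdsWithin] with L hL
        refine hscale h hu' L hL ?_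
        change ENNReal.ofReal _ * N + _ ≤ 1
        rw [hN0, mul_zero, zero_add]
        simpa using hs1.le
      rw [hzero, mul_zero]
      exact bot_le
  · set n := N.toReal
    have hn : 0 < n := ENNReal.toReal_pos hN0 hNtop
    have hNn : N = ENNReal.ofReal n := (ENNReal.ofReal_toReal hNtop).symm
    have hmain := hscale h hu' (s / (1 - s) * n) (by positivity) (by
      change ENNReal.ofReal _ * N + _ ≤ 1
      rw [hNn, ← ENNReal.ofReal_mul (by positivity), ← ENNReal.ofReal_add (by positivity) hs.le]
      refine ENNReal.ofReal_le_one.2 (le_of_eq ?_)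
      have : 1 - s ≠ 0 := by linarith
      field_simp
      ring)
    calc N⁻¹ * TMfunc p θ μ u
        ≤ N⁻¹ * (ENNReal.ofReal (s / (1 - s) * n) * TMC p (p - 1) θ σ) := by gcongr
      _ = N⁻¹ * N * (ENNReal.ofReal (s / (1 - s)) * TMC p (p - 1) θ σ) := by
        rw [ENNReal.ofReal_mul hK.le, ← hNn]
        ring
      _ = ENNReal.ofReal (s / (1 - s)) * TMC p (p - 1) θ σ := by
        rw [ENNReal.inv_mul_cancel hN0 hNtop, one_mul]

theorem stmt_13 (p α θ σ μ : ℝ) (hp : 2 ≤ p) (hα : α = p - 1) (hθ : 0 ≤ θ)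
    (hσ : 0 < σ) (hσ' : σ ≤ muC α θ) (hμ : 0 < μ) (hμσ : μ < σ) :
    TMSC p α θ μ ≤
      ENNReal.ofReal ((μ / σ) ^ (p - 1) / (1 - (μ / σ) ^ (p - 1))) * TMC p α θ σ ∧
    (TMC p α θ (muC α θ) < ⊤ →
      ∀ μ' : ℝ, 0 < μ' → μ' < muC α θ → TMSC p α θ μ' < ⊤) := by
  subst hα
  refine ⟨TMSC_le_mul_TMC hp hθ hσ hμ hμσ, fun hT μ' hμ' hlt => ?_⟩
  exact (TMSC_le_mul_TMC hp hθ (hμ'.trans hlt) hμ' hlt).trans_lt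
    (ENNReal.mul_lt_top ENNReal.ofReal_lt_top hT)
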